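/- Let f : ℝⁿ → ℝ be C³ and define χᵢⱼ = ‖∇f‖² ∂ᵢ∂ⱼf + Δf (δᵢⱼ − ∂ᵢf ∂ⱼf). Then for every x ∈ ℝⁿ: Σᵢⱼ (∂ᵢ χᵢⱼ)(x) ∂ⱼf(x) = (1/2) ‖∇(‖∇f‖²)(x)‖² + ⟨∇(Δf)(x), ∇f(x)⟩ − (Δf(x))² ‖∇f(x)‖² − (1/2) Δf(x) ⟨∇f(x), ∇(‖∇f‖²)(x)⟩. -/

import Mathlib

/-- The `i`-th partial derivative `∂ᵢ f` of a function `f : ℝⁿ → ℝ`. -/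
noncomputable def pd {n : ℕ} (f : (Fin n → ℝ) → ℝ) (i : Fin n) (x : Fin n → ℝ) : ℝ :=
  fderiv ℝ f x (Pi.single i 1)

/-- The second partial derivative `∂ᵢ ∂ⱼ f` (entry of the Hessian matrix). -/
noncomputable def pd2 {n : ℕ} (f : (Fin n → ℝ) → ℝ) (i j : Fin n) (x : Fin n → ℝ) : ℝ :=
  pd (pd f j) i x

/-- The squared gradient norm `‖∇f‖² = ∑ i, (∂ᵢ f)²`. -/
noncomputable def gradNormSq {n : ℕ} (f : (Fin n → ℝ) → ℝ) (x : Fin n → ℝ) : ℝ :=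
  ∑ i, pd f i x ^ 2

/-- The Euclidean Laplacian `Δf = ∑ i, ∂ᵢ ∂ᵢ f`. -/
noncomputable def lap {n : ℕ} (f : (Fin n → ℝ) → ℝ) (x : Fin n → ℝ) : ℝ :=
  ∑ i, pd2 f i i x

/-- The deformed metric `g̃ᵢⱼ = δᵢⱼ - ∂ᵢf ∂ⱼf` as a matrix. -/
noncomputable def gTilde {n : ℕ} (f : (Fin n → ℝ) → ℝ) (x : Fin n → ℝ) :
    Matrix (Fin n) (Fin n) ℝ :=
  1 - Matrix.vecMulVec (fun i => pd f i x) (fun i => pd f i x)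

/-- The Christoffel symbols `Γ̃ᵏᵢⱼ` of the metric `g̃` in Cartesian coordinates. -/
noncomputable def christoffel {n : ℕ} (f : (Fin n → ℝ) → ℝ) (k i j : Fin n)
    (x : Fin n → ℝ) : ℝ :=
  (1 / 2) * ∑ l, (gTilde f x)⁻¹ k l *
    (pd (fun y => gTilde f y j l) i x + pd (fun y => gTilde f y i l) j x
      - pd (fun y => gTilde f y i j) l x)

/-- The paper's symmetric tensor field
`χᵢⱼ = ‖∇f‖² ∂ᵢ∂ⱼf + Δf (δᵢⱼ - ∂ᵢf ∂ⱼf)` in Cartesian coordinates. -/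
noncomputable def chi {n : ℕ} (f : (Fin n → ℝ) → ℝ) (i j : Fin n) (x : Fin n → ℝ) : ℝ :=
  gradNormSq f x * pd2 f i j x
    + lap f x * ((if i = j then (1 : ℝ) else 0) - pd f i x * pd f j x)

/-- The divergence of the tensor field `χ` evaluated on a vector `V`:
`(div χ)(V) = ∑ i j, (∂ᵢ χᵢⱼ) Vⱼ`. -/
noncomputable def divChi {n : ℕ} (f : (Fin n → ℝ) → ℝ) (V : Fin n → ℝ)
    (x : Fin n → ℝ) : ℝ :=
  ∑ i, ∑ j, pd (fun y => chi f i j y) i x * V j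

section PartialDerivatives

variable {n : ℕ} {f g : (Fin n → ℝ) → ℝ} {x : Fin n → ℝ}

theorem pd_add (hf : DifferentiableAt ℝ f x) (hg : DifferentiableAt ℝ g x) (i : Fin n) :
    pd (fun y => f y + g y) i x = pd f i x + pd g i x := by
  simp [pd, fderiv_fun_add hf hg]

theorem pd_mul (hf : DifferentiableAt ℝ f x) (hg : DifferentiableAt ℝ g x) (i : Fin n) :
    pd (fun y => f y * g y) i x = pd f i x * g x + f x * pd g i x := by
  simp [pd, fderiv_fun_mul hf hg]
  ring

theorem pd_const_sub (c : ℝ) (i : Fin n) :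
    pd (fun y => c - f y) i x = -pd f i x := by
  simp [pd, fderiv_const_sub]

theorem pd_sum {ι : Type*} {s : Finset ι} {F : ι → (Fin n → ℝ) → ℝ}
    (hF : ∀ k ∈ s, DifferentiableAt ℝ (F k) x) (i : Fin n) :
    pd (fun y => ∑ k ∈ s, F k y) i x = ∑ k ∈ s, pd (F k) i x := by
  simp [pd, fderiv_fun_sum hF]

theorem ContDiff.pd {m k : WithTop ℕ∞} (hf : ContDiff ℝ k f) (hmk : m + 1 ≤ k) (i : Fin n) :
    ContDiff ℝ m (pd f i) :=
  (hf.fderiv_right hmk).clm_apply contDiff_const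

theorem pd_comm (hf : ContDiff ℝ 2 f) (i j : Fin n) : pd (pd f i) j = pd (pd f j) i := by
  have hd : Differentiable ℝ (fderiv ℝ f) :=
    (hf.fderiv_right (m := 1) (by norm_num)).differentiable (by norm_num)
  have key (a b : Fin n) (x : Fin n → ℝ) :
      pd (pd f a) b x = fderiv ℝ (fderiv ℝ f) x (Pi.single b 1) (Pi.single a 1) := by
    change fderiv ℝ (fun y => fderiv ℝ f y (Pi.single a 1)) x (Pi.single b 1) = _
    simp [fderiv_clm_apply (hd x) (differentiableAt_const _)]
  ext x
  rw [key, key]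
  exact (hf.contDiffAt.isSymmSndFDerivAt (by simp)) _ _

theorem pd_gradNormSq (hf : ContDiff ℝ 2 f) (i : Fin n) (x : Fin n → ℝ) :
    pd (gradNormSq f) i x = 2 * ∑ j, pd2 f i j x * pd f j x := by
  have hd (j : Fin n) : DifferentiableAt ℝ (pd f j) x :=
    (hf.pd (m := 1) (by norm_num) j).differentiable (by norm_num) x
  have h : gradNormSq f = fun y => ∑ j, pd f j y * pd f j y := by
    ext y; simp [gradNormSq, sq]
  rw [h, pd_sum fun j _ => (hd j).fun_mul (hd j), Finset.mul_sum]
  refine Finset.sum_congr rfl fun j _ => ?_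
  rw [pd_mul (hd j) (hd j), pd2]
  ring

/-- The divergence of the Hessian is the gradient of the Laplacian. -/
theorem sum_pd_pd2 (hf : ContDiff ℝ 3 f) (j : Fin n) (x : Fin n → ℝ) :
    ∑ i, pd (pd2 f i j) i x = pd (lap f) j x := by
  have h1 (i : Fin n) : ContDiff ℝ 2 (pd f i) := hf.pd (by norm_num) i
  have hd (i : Fin n) : DifferentiableAt ℝ (pd2 f i i) x :=
    ((h1 i).pd (m := 1) (by norm_num) i).differentiable (by norm_num) x
  change _ = pd (fun y => ∑ i, pd2 f i i y) j x
  rw [pd_sum fun i _ => hd i]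
  refine Finset.sum_congr rfl fun i _ => ?_
  change pd (pd (pd f j) i) i x = pd (pd (pd f i) i) j x
  rw [pd_comm (hf.of_le (by norm_num)) j i, pd_comm (h1 i) j i]

theorem pd_chi (hf : ContDiff ℝ 3 f) (i j : Fin n) (x : Fin n → ℝ) :
    pd (chi f i j) i x
      = pd (gradNormSq f) i x * pd2 f i j x + gradNormSq f x * pd (pd2 f i j) i x
        + (pd (lap f) i x * ((if i = j then (1 : ℝ) else 0) - pd f i x * pd f j x)
          - lap f x * (pd2 f i i x * pd f j x + pd f i x * pd2 f i j x)) := by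
  have h1 (i : Fin n) : ContDiff ℝ 2 (pd f i) := hf.pd (by norm_num) i
  have d1 (i : Fin n) : DifferentiableAt ℝ (pd f i) x := (h1 i).differentiable (by norm_num) x
  have d2 (i j : Fin n) : DifferentiableAt ℝ (pd2 f i j) x :=
    ((h1 j).pd (m := 1) (by norm_num) i).differentiable (by norm_num) x
  have dN : DifferentiableAt ℝ (gradNormSq f) x :=
    DifferentiableAt.fun_sum fun i _ => (d1 i).pow 2
  have dL : DifferentiableAt ℝ (lap f) x := DifferentiableAt.fun_sum fun i _ => d2 i i
  have dg := (d1 i).fun_mul (d1 j)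
  change pd (fun y => gradNormSq f y * pd2 f i j y
    + lap f y * ((if i = j then (1 : ℝ) else 0) - pd f i y * pd f j y)) i x = _
  rw [pd_add (dN.fun_mul (d2 i j)) (dL.fun_mul (dg.const_sub _)), pd_mul dN (d2 i j),
    pd_mul dL (dg.const_sub _), pd_const_sub, pd_mul (d1 i) (d1 j)]
  simp only [pd2]
  ring

end PartialDerivatives

/-- Flat-space version of Corollary 3.1: for a `C³` function `f : ℝⁿ → ℝ`,
`(div χ)(∇f) = (1/2)‖∇‖∇f‖²‖² + ⟨∇Δf, ∇f⟩ - (Δf)²‖∇f‖² - (1/2) Δf ⟨∇f, ∇‖∇f‖²⟩`. -/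
theorem stmt_10 {n : ℕ} (f : (Fin n → ℝ) → ℝ) (hf : ContDiff ℝ 3 f) (x : Fin n → ℝ) :
    divChi f (fun j => pd f j x) x
      = (1 / 2) * (∑ i, pd (gradNormSq f) i x ^ 2)
        + (∑ i, pd (lap f) i x * pd f i x)
        - lap f x ^ 2 * gradNormSq f x
        - (1 / 2) * lap f x * (∑ i, pd f i x * pd (gradNormSq f) i x) := by
  have hN (i : Fin n) : ∑ j, pd2 f i j x * pd f j x = pd (gradNormSq f) i x / 2 := by
    rw [pd_gradNormSq (hf.of_le (by norm_num))]
    ring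
  have hT : ∑ i, ∑ j, pd (pd2 f i j) i x * pd f j x = ∑ j, pd (lap f) j x * pd f j x := by
    rw [Finset.sum_comm]
    simp_rw [← Finset.sum_mul, sum_pd_pd2 hf]
  have hrow (i : Fin n) : ∑ j, pd (chi f i j) i x * pd f j x
      = (1 / 2) * pd (gradNormSq f) i x ^ 2
        + gradNormSq f x * ∑ j, pd (pd2 f i j) i x * pd f j x
        + pd (lap f) i x * pd f i x - gradNormSq f x * (pd (lap f) i x * pd f i x)
        - lap f x * gradNormSq f x * pd2 f i i x
        - (1 / 2) * lap f x * (pd f i x * pd (gradNormSq f) i x) := by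
    have hterm (j : Fin n) : pd (chi f i j) i x * pd f j x
        = (pd (gradNormSq f) i x - lap f x * pd f i x) * (pd2 f i j x * pd f j x)
          + gradNormSq f x * (pd (pd2 f i j) i x * pd f j x)
          + pd (lap f) i x * (if i = j then pd f j x else 0)
          - (pd (lap f) i x * pd f i x + lap f x * pd2 f i i x) * pd f j x ^ 2 := by
      rw [pd_chi hf]
      split_ifs <;> ring
    simp_rw [hterm, Finset.sum_sub_distrib, Finset.sum_add_distrib, ← Finset.mul_sum, hN]
    rw [Finset.sum_ite_eq, if_pos (Finset.mem_univ i), ← gradNormSq]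
    ring
  change ∑ i, ∑ j, pd (chi f i j) i x * pd f j x = _
  simp_rw [hrow, Finset.sum_sub_distrib, Finset.sum_add_distrib, ← Finset.mul_sum, hT]
  rw [← lap]
  ring
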